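/- Every compact Ptolemy space X with the inversion property (I) is two-point homogeneous: for any two ordered pairs (x,y) and (x',y') of distinct points of X there exists a Möbius automorphism f of X with f(x) = x' and f(y) = y'. -/

import Mathlib

open scoped ENNReal

namespace Mobius

/-- An extended metric on `X`, allowed to have (at most) one infinitely remote point,
which is recorded in the field `rem`.  Distances take values in `ℝ≥0∞`, and the value `⊤`
occurs exactly on pairs of distinct points one of which is the remote point. -/
structure ExtMetric (X : Type*) where
  d : X → X → ℝ≥0∞
  rem : Option X
  symm : ∀ x y, d x y = d y x
  d_self : ∀ x, d x x = 0
  pos : ∀ x y, x ≠ y → 0 < d x y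
  triangle : ∀ x y z, d x z ≤ d x y + d y z
  d_eq_top_iff : ∀ x y, d x y = ⊤ ↔ (x ≠ y ∧ (rem = some x ∨ rem = some y))

/-- The finite factor of a distance used in cross-ratio triples: infinite factors are
dropped (replaced by `1`), in accordance with the standard conventions for cross-ratio
triples of quadruples containing the infinitely remote point. -/
noncomputable def ExtMetric.fd {X : Type*} (d : ExtMetric X) (x y : X) : ℝ :=
  if d.d x y = ⊤ then 1 else (d.d x y).toReal

/-- A representative in `ℝ³` of the cross-ratio triple
`crt(x,y,z,u) = (d(x,y)d(z,u) : d(x,z)d(y,u) : d(x,u)d(y,z)) ∈ ℝP²`,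
with the standard conventions when the infinitely remote point occurs among the points. -/
noncomputable def crtVec {X : Type*} (d : ExtMetric X) (x y z u : X) : ℝ × ℝ × ℝ :=
  (d.fd x y * d.fd z u, d.fd x z * d.fd y u, d.fd x u * d.fd y z)

/-- A quadruple is admissible if no entry occurs three or four times in it. -/
def Admissible {X : Type*} (x y z u : X) : Prop :=
  ¬(x = y ∧ y = z) ∧ ¬(x = y ∧ y = u) ∧ ¬(x = z ∧ z = u) ∧ ¬(y = z ∧ z = u)

/-- Two vectors in `ℝ³` represent the same point of the projective plane (they are
positively proportional). -/
def ProjEq (v w : ℝ × ℝ × ℝ) : Prop :=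
  ∃ lam : ℝ, 0 < lam ∧ w = lam • v

theorem ProjEq.refl (v : ℝ × ℝ × ℝ) : ProjEq v v :=
  ⟨1, one_pos, (one_smul ℝ v).symm⟩

theorem ProjEq.symm {v w : ℝ × ℝ × ℝ} (h : ProjEq v w) : ProjEq w v := by
  obtain ⟨l, hl, rfl⟩ := h
  exact ⟨l⁻¹, inv_pos.mpr hl, by rw [smul_smul, inv_mul_cancel₀ hl.ne', one_smul]⟩

theorem ProjEq.trans' {v w u : ℝ × ℝ × ℝ} (h1 : ProjEq v w) (h2 : ProjEq v u) :
    ProjEq w u := by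
  obtain ⟨l, hl, rfl⟩ := h1
  obtain ⟨m, hm, rfl⟩ := h2
  refine ⟨m * l⁻¹, by positivity, ?_⟩
  rw [smul_smul, mul_assoc, inv_mul_cancel₀ hl.ne', mul_one]

/-- A Möbius structure on a set `X`: a (maximal) class of pairwise Möbius-equivalent
extended metrics on `X`, i.e. metrics defining the same cross-ratio triples on all
admissible quadruples. -/
structure MobiusStructure (X : Type*) where
  M : Set (ExtMetric X)
  nonempty : M.Nonempty
  compat : ∀ d ∈ M, ∀ d' ∈ M, ∀ x y z u : X, Admissible x y z u →
    ProjEq (crtVec d x y z u) (crtVec d' x y z u)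
  maximal : ∀ d' : ExtMetric X,
    (∀ d ∈ M, ∀ x y z u : X, Admissible x y z u →
      ProjEq (crtVec d x y z u) (crtVec d' x y z u)) → d' ∈ M

/-- The Möbius structure generated by a single extended metric. -/
def MobiusStructure.ofMetric {X : Type*} (d₀ : ExtMetric X) : MobiusStructure X where
  M := {d | ∀ x y z u : X, Admissible x y z u →
    ProjEq (crtVec d₀ x y z u) (crtVec d x y z u)}
  nonempty := ⟨d₀, fun _ _ _ _ _ => ProjEq.refl _⟩
  compat := fun _ hd _ hd' x y z u ha => (hd x y z u ha).trans' (hd' x y z u ha)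
  maximal := fun _ h => h d₀ (fun _ _ _ _ _ => ProjEq.refl _)

/-- A Möbius structure is Ptolemy if the entries of every cross-ratio triple of every
admissible quadruple satisfy the triangle inequality. -/
def IsPtolemyStructure {X : Type*} (S : MobiusStructure X) : Prop :=
  ∀ d ∈ S.M, ∀ x y z u : X, Admissible x y z u →
    (crtVec d x y z u).1 ≤ (crtVec d x y z u).2.1 + (crtVec d x y z u).2.2 ∧
    (crtVec d x y z u).2.1 ≤ (crtVec d x y z u).1 + (crtVec d x y z u).2.2 ∧
    (crtVec d x y z u).2.2 ≤ (crtVec d x y z u).1 + (crtVec d x y z u).2.1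

/-- The topology of a Möbius space: generated by the open balls of the metrics of the
structure (centered at points distinct from the respective remote points) together with
the complements of the closed balls. -/
def mobiusTop {X : Type*} (S : MobiusStructure X) : TopologicalSpace X :=
  TopologicalSpace.generateFrom
    {s | ∃ d ∈ S.M, ∃ x : X, d.rem ≠ some x ∧ ∃ r : ℝ≥0∞, 0 < r ∧ r ≠ ⊤ ∧
      (s = {y | d.d y x < r} ∨ s = {y | r < d.d y x})}

/-- Connected components of subsets with respect to the Möbius topology. -/
def mobiusCCIn {X : Type*} (S : MobiusStructure X) (F : Set X) (x : X) : Set X :=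
  @connectedComponentIn X (mobiusTop S) F x

/-- The pair `(x,z)` separates the pair `(y,u)` in `σ`:  `y` and `u` lie in different
connected components of `σ \ {x,z}`. -/
def SeparatesIn {X : Type*} (S : MobiusStructure X) (σ : Set X) (x z y u : X) : Prop :=
  u ∉ mobiusCCIn S (σ \ {x, z}) y

/-- `σ` is homeomorphic to the circle `S¹` (with respect to the Möbius topology). -/
def HomeoToCircle {X : Type*} (S : MobiusStructure X) (σ : Set X) : Prop :=
  letI : TopologicalSpace X := mobiusTop S
  Nonempty (σ ≃ₜ Metric.sphere (0 : ℂ) 1)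

/-- `X` is homeomorphic to the sphere `Sⁿ ⊆ ℝ^{n+1}` (w.r.t. the Möbius topology). -/
def HomeoToSphere {X : Type*} (S : MobiusStructure X) (n : ℕ) : Prop :=
  letI : TopologicalSpace X := mobiusTop S
  Nonempty (X ≃ₜ Metric.sphere (0 : EuclideanSpace ℝ (Fin (n + 1))) 1)

/-- The subset `A ⊆ X` is homeomorphic to `ℝᵖ` (w.r.t. the Möbius topology). -/
def SubsetHomeoToEuclidean {X : Type*} (S : MobiusStructure X) (A : Set X) (p : ℕ) : Prop :=
  letI : TopologicalSpace X := mobiusTop S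
  Nonempty (A ≃ₜ EuclideanSpace ℝ (Fin p))

/-- The subset `A ⊆ X` is homeomorphic to `ℝ` (w.r.t. the Möbius topology). -/
def SubsetHomeoToReal {X : Type*} (S : MobiusStructure X) (A : Set X) : Prop :=
  letI : TopologicalSpace X := mobiusTop S
  Nonempty (A ≃ₜ ℝ)

/-- A Ptolemy circle: a subset homeomorphic to `S¹` on which the Ptolemy equality holds
for every quadruple of distinct points `(x,y,z,u)` such that `(x,z)` separates `(y,u)`. -/
def IsPtolemyCircle {X : Type*} (S : MobiusStructure X) (σ : Set X) : Prop :=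
  HomeoToCircle S σ ∧
  ∀ d ∈ S.M, ∀ x ∈ σ, ∀ y ∈ σ, ∀ z ∈ σ, ∀ u ∈ σ,
    x ≠ y → x ≠ z → x ≠ u → y ≠ z → y ≠ u → z ≠ u →
    SeparatesIn S σ x z y u →
    d.d x z * d.d y u = d.d x y * d.d z u + d.d x u * d.d y z

/-- A Möbius automorphism of `X`: a bijection preserving all cross-ratio triples. -/
def IsMobiusAuto {X : Type*} (S : MobiusStructure X) (f : X → X) : Prop :=
  Function.Bijective f ∧ ∀ d ∈ S.M, ∀ x y z u : X, Admissible x y z u →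
    ProjEq (crtVec d x y z u) (crtVec d (f x) (f y) (f z) (f u))

/-- A metric sphere between two distinct points `ω`, `ω'`. -/
def IsMetricSphere {X : Type*} (S : MobiusStructure X) (ω ω' : X) (Sp : Set X) : Prop :=
  ∃ d ∈ S.M, d.rem = some ω' ∧ ∃ r : ℝ≥0∞, 0 < r ∧ r ≠ ⊤ ∧ Sp = {x | d.d x ω = r}

/-- A space inversion with respect to `ω`, `ω'` and a metric sphere `Sp` between them. -/
def IsSpaceInversion {X : Type*} (S : MobiusStructure X) (ω ω' : X) (Sp : Set X)
    (φ : X → X) : Prop :=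
  IsMobiusAuto S φ ∧ Function.Involutive φ ∧ (∀ x, φ x ≠ x) ∧ φ ω = ω' ∧
  φ '' Sp = Sp ∧ ∀ σ : Set X, IsPtolemyCircle S σ → ω ∈ σ → ω' ∈ σ → φ '' σ = σ

/-- Property (E): existence of at least one Ptolemy circle. -/
def PropertyE {X : Type*} (S : MobiusStructure X) : Prop :=
  ∃ σ : Set X, IsPtolemyCircle S σ

/-- Property (I): existence and uniqueness of space inversions. -/
def PropertyI {X : Type*} (S : MobiusStructure X) : Prop :=
  ∀ ω ω' : X, ω ≠ ω' → ∀ Sp : Set X, IsMetricSphere S ω ω' Sp →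
    ∃! φ : X → X, IsSpaceInversion S ω ω' Sp φ

/-- The Möbius space is compact. -/
def MobiusCompact {X : Type*} (S : MobiusStructure X) : Prop :=
  letI : TopologicalSpace X := mobiusTop S
  CompactSpace X

/-- Property (H), the homothety property. -/
def PropertyH {X : Type*} (S : MobiusStructure X) : Prop :=
  ∀ ω ω' : X, ω ≠ ω' → ∀ σ : Set X, IsPtolemyCircle S σ → ω ∈ σ → ω' ∈ σ →
    ∀ x x' : X, x ∈ σ \ {ω, ω'} → x' ∈ mobiusCCIn S (σ \ {ω, ω'}) x →
    ∃ γ : X → X, IsMobiusAuto S γ ∧ γ ω = ω ∧ γ ω' = ω' ∧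
      (∀ σ' : Set X, IsPtolemyCircle S σ' → ω ∈ σ' → ω' ∈ σ' →
        γ '' σ' = σ' ∧ ∀ y ∈ σ' \ {ω, ω'}, γ y ∈ mobiusCCIn S (σ' \ {ω, ω'}) y) ∧
      γ x = x'

/-- A Ptolemy line in `X_ω`: a Ptolemy circle through `ω` with `ω` removed. -/
def IsPtolemyLine {X : Type*} (S : MobiusStructure X) (ω : X) (l : Set X) : Prop :=
  ∃ σ : Set X, IsPtolemyCircle S σ ∧ ω ∈ σ ∧ l = σ \ {ω}

/-- `c : ℝ → X` is a unit-speed parameterization of `l ⊆ X` w.r.t. the metric `d`. -/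
def IsUnitSpeed {X : Type*} (d : ExtMetric X) (l : Set X) (c : ℝ → X) : Prop :=
  Set.range c = l ∧ ∀ s t : ℝ, d.d (c s) (c t) = ENNReal.ofReal |s - t|

/-- `b` is a Busemann function of the Ptolemy line `l ⊆ X_ω`:  up to an additive constant,
`b x = lim_{t→∞} (d(x,c(t)) − t)` for a unit-speed parameterization `c` of `l`. -/
def IsBusemannOf {X : Type*} (S : MobiusStructure X) (d : ExtMetric X) (ω : X)
    (l : Set X) (b : X → ℝ) : Prop :=
  IsPtolemyLine S ω l ∧ ∃ c : ℝ → X, IsUnitSpeed d l c ∧ ∃ C : ℝ, ∀ x : X, x ≠ ω →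
    Filter.Tendsto (fun t => (d.d x (c t)).toReal - t) Filter.atTop (nhds (b x + C))

/-- The fiber through `x` of the canonical fibration `π_ω`: the set of points on which
every Busemann function of every Ptolemy line of `X_ω` takes the same value as at `x`. -/
def mobiusFiber {X : Type*} (S : MobiusStructure X) (d : ExtMetric X) (ω : X) (x : X) :
    Set X :=
  {y | y ≠ ω ∧ ∀ (l : Set X) (b : X → ℝ), IsBusemannOf S d ω l b → b y = b x}

/-- The base `B_ω` of the canonical fibration: the set of all fibers. -/
def mobiusBase {X : Type*} (S : MobiusStructure X) (d : ExtMetric X) (ω : X) :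
    Set (Set X) :=
  {F | ∃ x : X, x ≠ ω ∧ F = mobiusFiber S d ω x}

/-- The distance between two fibers. -/
noncomputable def fiberDist {X : Type*} (d : ExtMetric X) (F F' : Set X) : ℝ :=
  sInf {r : ℝ | ∃ x ∈ F, ∃ x' ∈ F', r = (d.d x x').toReal}

/-- Two Möbius spaces are Möbius equivalent: there is a bijection between them
preserving all cross-ratio triples. -/
def MobiusEquiv {X Y : Type*} (S : MobiusStructure X) (S' : MobiusStructure Y) : Prop :=
  ∃ f : X → Y, Function.Bijective f ∧ ∀ d ∈ S.M, ∀ d' ∈ S'.M, ∀ x y z u : X,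
    Admissible x y z u → ProjEq (crtVec d x y z u) (crtVec d' (f x) (f y) (f z) (f u))

/-- The standard extended Euclidean metric on the one-point extension
`ℝ̂ⁿ = ℝⁿ ∪ {∞}`, where `∞` is encoded by `none`. -/
noncomputable def stdExtMetric (n : ℕ) : ExtMetric (Option (EuclideanSpace ℝ (Fin n))) where
  d x y :=
    match x, y with
    | none, none => 0
    | none, some _ => ⊤
    | some _, none => ⊤
    | some a, some b => ENNReal.ofReal (dist a b)
  rem := some none
  symm := by intro x y; cases x <;> cases y <;> simp [dist_comm]
  d_self := by intro x; cases x <;> simp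
  pos := by
    intro x y h
    cases x <;> cases y
    · exact absurd rfl h
    · simp
    · simp
    · simp only [ne_eq, Option.some.injEq] at h
      exact ENNReal.ofReal_pos.mpr (dist_pos.mpr h)
  triangle := by
    intro x y z
    cases x <;> cases y <;> cases z <;>
      simp only [le_refl, le_top, zero_le, zero_add, add_zero, top_add, add_top,
        top_le_iff]
    rw [← ENNReal.ofReal_add dist_nonneg dist_nonneg]
    exact ENNReal.ofReal_le_ofReal (dist_triangle _ _ _)
  d_eq_top_iff := by
    intro x y
    cases x <;> cases y <;>
      simp [ENNReal.ofReal_ne_top]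


section Scaling

open Filter Topology

/-- `f` multiplies all distances by `c`. -/
def ScalesBy {Y : Type*} [MetricSpace Y] (f : Y → Y) (c : ℝ) : Prop :=
  ∀ p q, dist (f p) (f q) = c * dist p q

variable {Y : Type*} [MetricSpace Y]

theorem ScalesBy.comp {f g : Y → Y} {a b : ℝ} (hf : ScalesBy f a) (hg : ScalesBy g b) :
    ScalesBy (f ∘ g) (a * b) := fun p q => by
  simp only [Function.comp_apply, hf _ _, hg _ _, mul_assoc]

theorem ScalesBy.pow {f : Equiv.Perm Y} {a : ℝ} (hf : ScalesBy f a) (n : ℕ) :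
    ScalesBy (f ^ n : Equiv.Perm Y) (a ^ n) := by
  induction n with
  | zero => intro p q; simp
  | succ n ih =>
    rw [pow_succ, pow_succ, Equiv.Perm.coe_mul]
    exact ih.comp hf

theorem ScalesBy.inv {f : Equiv.Perm Y} {a : ℝ} (ha : 0 < a) (hf : ScalesBy f a) :
    ScalesBy (f⁻¹ : Equiv.Perm Y) a⁻¹ := by
  intro p q
  have h := hf (f⁻¹ p) (f⁻¹ q)
  rw [show f (f⁻¹ p) = p from f.apply_symm_apply p,
    show f (f⁻¹ q) = q from f.apply_symm_apply q] at h
  rw [h, inv_mul_cancel_left₀ ha.ne']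

theorem exists_ultrafilter_tendsto [ProperSpace Y] (U : Ultrafilter ℕ) {u : ℕ → Y} {p : Y}
    {r : ℝ} (h : ∀ᶠ n in (U : Filter ℕ), dist (u n) p ≤ r) :
    ∃ y, Tendsto u U (𝓝 y) := by
  obtain ⟨y, -, hy⟩ := (isCompact_closedBall p r).ultrafilter_le_nhds (U.map u)
    (by rw [le_principal_iff]; exact h)
  exact ⟨y, hy⟩

/-- In a proper space, a sequence of scaling permutations with factors bounded away from `0`
and `∞` and with a convergent orbit `g n x → z` subconverges to one mapping `x` to `z`. -/
theorem exists_scaling_limit [ProperSpace Y] {g : ℕ → Equiv.Perm Y} {c : ℕ → ℝ} {a b : ℝ}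
    (ha : 0 < a) (hc : ∀ n, c n ∈ Set.Icc a b) (hg : ∀ n, ScalesBy (g n) (c n)) {x z : Y}
    (hx : Tendsto (fun n => g n x) atTop (𝓝 z)) :
    ∃ f : Equiv.Perm Y, ∃ l : ℝ, 0 < l ∧ ScalesBy f l ∧ f x = z := by
  set U : Ultrafilter ℕ := hyperfilter ℕ
  have hxU : Tendsto (fun n => g n x) U (𝓝 z) := hx.mono_left Nat.hyperfilter_le_atTop
  have hcpos : ∀ n, 0 < c n := fun n => ha.trans_le (hc n).1
  obtain ⟨l, hl, hcl⟩ : ∃ l ∈ Set.Icc a b, Tendsto c U (𝓝 l) := by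
    obtain ⟨l, hl, h⟩ := (isCompact_Icc (a := a) (b := b)).ultrafilter_le_nhds (U.map c)
      (by rw [le_principal_iff]; exact Eventually.of_forall (f := (U : Filter ℕ)) hc)
    exact ⟨l, hl, h⟩
  have hnear : ∀ᶠ n in (U : Filter ℕ), dist (g n x) z ≤ 1 :=
    (hxU.eventually (Metric.closedBall_mem_nhds z one_pos))
  have hlim : ∀ p, ∃ y, Tendsto (fun n => g n p) U (𝓝 y) := fun p => by
    refine exists_ultrafilter_tendsto U (p := z) (r := b * dist p x + 1) ?_
    filter_upwards [hnear] with n hn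
    have h1 := dist_triangle (g n p) (g n x) z
    rw [hg n] at h1
    have h2 := mul_le_mul_of_nonneg_right (hc n).2 (dist_nonneg (x := p) (y := x))
    linarith
  have hlim' : ∀ p, ∃ y, Tendsto (fun n => (g n)⁻¹ p) U (𝓝 y) := fun p => by
    refine exists_ultrafilter_tendsto U (p := x) (r := a⁻¹ * (dist p z + 1)) ?_
    filter_upwards [hnear] with n hn
    have h1 := (hg n).inv (hcpos n) p (g n x)
    rw [show (g n)⁻¹ (g n x) = x from (g n).symm_apply_apply x] at h1
    rw [h1]
    have h2 := dist_triangle_right p (g n x) z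
    exact mul_le_mul (inv_anti₀ ha (hc n).1) (by linarith) dist_nonneg (inv_pos.2 ha).le
  choose f hf using hlim
  choose k hk using hlim'
  have hfs : ScalesBy f l := fun p q => by
    refine tendsto_nhds_unique ((hf p).dist (hf q)) ?_
    simp only [hg _ _ _]
    exact hcl.mul_const _
  have hfk : ∀ p, f (k p) = p := fun p => by
    refine tendsto_nhds_unique (hf (k p)) ?_
    rw [tendsto_iff_dist_tendsto_zero]
    have h1 : ∀ n, dist (g n (k p)) p = c n * dist ((g n)⁻¹ p) (k p) := fun n => by
      rw [dist_comm _ (k p), ← hg n,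
        show g n ((g n)⁻¹ p) = p from (g n).apply_symm_apply p]
    simp only [h1]
    simpa using hcl.mul (tendsto_iff_dist_tendsto_zero.1 (hk p))
  have hl0 : 0 < l := ha.trans_le hl.1
  have hinj : Function.Injective f := fun p q h => by
    have h1 := hfs p q
    rw [h, dist_self, eq_comm, mul_eq_zero, or_iff_right hl0.ne'] at h1
    exact dist_eq_zero.1 h1
  exact ⟨Equiv.ofBijective f ⟨hinj, fun p => ⟨k p, hfk p⟩⟩, l, hl0, hfs,
    tendsto_nhds_unique (hf x) hxU⟩

theorem exists_scaling_of_contractions [ProperSpace Y] {x z : Y} {f h : Equiv.Perm Y} {a b : ℝ}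
    (ha : 0 < a) (ha1 : a < 1) (hf : ScalesBy f a) (hfz : f z = z)
    (hb : 0 < b) (hb1 : b < 1) (hh : ScalesBy h b) (hhx : h x = x) :
    ∃ g : Equiv.Perm Y, ∃ l : ℝ, 0 < l ∧ ScalesBy g l ∧ g x = z := by
  have hm : ∀ n : ℕ, ∃ m : ℕ, b ^ (m + 1) < a ^ n ∧ a ^ n ≤ b ^ m := fun n =>
    exists_nat_pow_near_of_lt_one (pow_pos ha n) (pow_le_one₀ ha.le ha1.le) hb hb1
  choose m hm1 hm2 using hm
  have hfix : ∀ n : ℕ, (h⁻¹ ^ n : Equiv.Perm Y) x = x := fun n =>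
    Equiv.Perm.pow_apply_eq_self_of_apply_eq_self (Equiv.Perm.inv_eq_iff_eq.2 hhx.symm) n
  have hfixz : ∀ n : ℕ, (f ^ n : Equiv.Perm Y) z = z := fun n =>
    Equiv.Perm.pow_apply_eq_self_of_apply_eq_self hfz n
  refine exists_scaling_limit (g := fun n => f ^ n * h⁻¹ ^ m n)
    (c := fun n => a ^ n * b⁻¹ ^ m n) (b := 1) hb (fun n => ⟨?_, ?_⟩) (fun n => ?_) ?_
  · rw [inv_pow, ← div_eq_mul_inv, le_div_iff₀ (pow_pos hb _), ← pow_succ']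
    exact (hm1 n).le
  · rw [inv_pow, ← div_eq_mul_inv, div_le_one (pow_pos hb _)]
    exact hm2 n
  · rw [Equiv.Perm.coe_mul]
    exact (hf.pow n).comp ((hh.inv hb).pow _)
  · rw [tendsto_iff_dist_tendsto_zero]
    have h1 : ∀ n : ℕ, dist ((f ^ n * h⁻¹ ^ m n : Equiv.Perm Y) x) z = a ^ n * dist x z :=
      fun n => by
        rw [Equiv.Perm.mul_apply, hfix, ← hf.pow n x z, hfixz]
    simp only [h1]
    simpa using (tendsto_pow_atTop_nhds_zero_of_lt_one ha.le ha1).mul_const (dist x z)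

theorem ScalesBy.eq_one_of_bounded {f : Equiv.Perm Y} {c C : ℝ} (hc : 0 < c)
    (hf : ScalesBy f c) (hC : ∀ p q : Y, dist p q ≤ C) {x z : Y} (hxz : x ≠ z) : c = 1 := by
  have key : ∀ {f : Equiv.Perm Y} {c : ℝ}, ScalesBy f c → c ≤ 1 := fun {f c} hf => by
    by_contra! h1
    obtain ⟨n, hn⟩ := ((tendsto_pow_atTop_atTop_of_one_lt h1).eventually_gt_atTop
      (C / dist x z)).exists
    rw [div_lt_iff₀ (dist_pos.2 hxz), ← hf.pow n] at hn
    exact absurd (hC _ _) hn.not_ge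
  refine (key hf).antisymm ?_
  simpa using (inv_le_one₀ hc).1 (key (hf.inv hc))

/-- If nontrivial scalings fixing `z` exist whenever the distances to `z` are not constant,
then the scaling permutations act transitively. -/
theorem exists_scaling_map_eq [ProperSpace Y]
    (H : ∀ z x y : Y, x ≠ z → y ≠ z → dist x z ≠ dist y z →
      ∃ f : Equiv.Perm Y, ∃ c : ℝ, 0 < c ∧ c ≠ 1 ∧ ScalesBy f c ∧ f z = z) (x z : Y) :
    ∃ f : Equiv.Perm Y, ∃ c : ℝ, 0 < c ∧ ScalesBy f c ∧ f x = z := by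
  by_cases hA : ∀ z : Y, ∃ f : Equiv.Perm Y, ∃ c : ℝ, 0 < c ∧ c < 1 ∧ ScalesBy f c ∧ f z = z
  · obtain ⟨f, a, ha, ha1, hf, hfz⟩ := hA z
    obtain ⟨h, b, hb, hb1, hh, hhx⟩ := hA x
    exact exists_scaling_of_contractions ha ha1 hf hfz hb hb1 hh hhx
  obtain ⟨z₀, hz₀⟩ := not_forall.1 hA
  have hconst : ∀ p q : Y, p ≠ z₀ → q ≠ z₀ → dist p z₀ = dist q z₀ := fun p q hp hq => by
    by_contra hne
    obtain ⟨f, c, hc, hc1, hf, hfz⟩ := H z₀ p q hp hq hne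
    rcases hc1.lt_or_gt with h | h
    · exact hz₀ ⟨f, c, hc, h, hf, hfz⟩
    · exact hz₀ ⟨f⁻¹, c⁻¹, inv_pos.2 hc, inv_lt_one_of_one_lt₀ h, hf.inv hc,
        Equiv.Perm.inv_eq_iff_eq.2 hfz.symm⟩
  obtain ⟨R, hR⟩ : ∃ R, ∀ p, dist p z₀ ≤ R := by
    by_cases h : ∃ q, q ≠ z₀
    · obtain ⟨q, hq⟩ := h
      refine ⟨dist q z₀, fun p => ?_⟩
      by_cases hp : p = z₀
      · rw [hp, dist_self]; exact dist_nonneg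
      · exact (hconst p q hp hq).le
    · push Not at h
      exact ⟨0, fun p => by rw [h p, dist_self]⟩
  have hC : ∀ p q : Y, dist p q ≤ R + R := fun p q =>
    (dist_triangle_right p q z₀).trans (add_le_add (hR p) (hR q))
  have hall : ∀ w p q : Y, p ≠ w → q ≠ w → dist p w = dist q w := fun w p q hp hq => by
    by_contra hne
    obtain ⟨f, c, hc, hc1, hf, -⟩ := H w p q hp hq hne
    exact hc1 (hf.eq_one_of_bounded hc hC hp)
  have heq : ∀ p q p' q' : Y, p ≠ q → p' ≠ q' → dist p q = dist p' q' :=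
    fun p q p' q' h h' => by
      by_cases hpq : p = q'
      · subst hpq
        rw [dist_comm]
        exact hall _ _ _ h.symm h'
      · rw [dist_comm p q, hall p q q' h.symm (Ne.symm hpq), dist_comm, hall q' p p' hpq h']
  classical
  refine ⟨Equiv.swap x z, 1, one_pos, fun p q => ?_, Equiv.swap_apply_left x z⟩
  rw [one_mul]
  by_cases hpq : p = q
  · rw [hpq, dist_self, dist_self]
  · exact heq _ _ _ _ ((Equiv.swap x z).injective.ne hpq) hpq

end Scaling

section FiniteDistance

variable {X : Type*} (d : ExtMetric X)

theorem ExtMetric.fd_self (x : X) : d.fd x x = 0 := by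
  simp [ExtMetric.fd, d.d_self]

theorem ExtMetric.fd_comm (x y : X) : d.fd x y = d.fd y x := by
  simp [ExtMetric.fd, d.symm x y]

variable {d}

theorem ExtMetric.fd_pos {x y : X} (h : x ≠ y) : 0 < d.fd x y := by
  unfold ExtMetric.fd
  split_ifs with ht
  · exact one_pos
  · exact ENNReal.toReal_pos (d.pos x y h).ne' ht

theorem ExtMetric.fd_nonneg (x y : X) : 0 ≤ d.fd x y := by
  rcases eq_or_ne x y with rfl | h
  · rw [d.fd_self]
  · exact (ExtMetric.fd_pos h).le

variable {ω : X} (hd : d.rem = some ω)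
include hd

theorem ExtMetric.fd_rem {x : X} (h : x ≠ ω) : d.fd x ω = 1 := by
  rw [ExtMetric.fd, if_pos ((d.d_eq_top_iff x ω).2 ⟨h, Or.inr hd⟩)]

theorem ExtMetric.d_ne_top {x y : X} (hx : x ≠ ω) (hy : y ≠ ω) : d.d x y ≠ ⊤ := by
  rw [Ne, d.d_eq_top_iff, hd]
  simp [hx.symm, hy.symm]

theorem ExtMetric.d_eq_ofReal {x y : X} (hx : x ≠ ω) (hy : y ≠ ω) :
    d.d x y = ENNReal.ofReal (d.fd x y) := by
  have h := ExtMetric.d_ne_top hd hx hy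
  rw [ExtMetric.fd, if_neg h, ENNReal.ofReal_toReal h]

theorem ExtMetric.fd_triangle {x y z : X} (hx : x ≠ ω) (hy : y ≠ ω) (hz : z ≠ ω) :
    d.fd x z ≤ d.fd x y + d.fd y z := by
  have h := d.triangle x y z
  rw [d_eq_ofReal hd hx hz, d_eq_ofReal hd hx hy, d_eq_ofReal hd hy hz,
    ← ENNReal.ofReal_add (fd_nonneg _ _) (fd_nonneg _ _)] at h
  exact (ENNReal.ofReal_le_ofReal_iff (add_nonneg (fd_nonneg _ _) (fd_nonneg _ _))).1 h

end FiniteDistance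

theorem isCompact_mobiusTop_closedBall {X : Type*} {S : MobiusStructure X}
    (hcomp : MobiusCompact S) {d : ExtMetric X} (hdM : d ∈ S.M) {p : X} (hp : d.rem ≠ some p)
    {r : ℝ≥0∞} (hr : 0 < r) (hr' : r ≠ ⊤) :
    @IsCompact X (mobiusTop S) {y | d.d y p ≤ r} := by
  let t : TopologicalSpace X := mobiusTop S
  have hX : @CompactSpace X t := hcomp
  have hopen : IsOpen {y : X | r < d.d y p} :=
    TopologicalSpace.isOpen_generateFrom_of_mem ⟨d, hdM, p, hp, r, hr, hr', Or.inr rfl⟩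
  have hcompl : {y : X | r < d.d y p}ᶜ = {y : X | d.d y p ≤ r} :=
    Set.ext fun y => not_lt (α := ℝ≥0∞)
  rw [← hcompl]
  exact hopen.isClosed_compl.isCompact

/-- In a compact Möbius space, a metric of the structure with infinitely remote point `ω` is
a proper metric on the complement of `ω`. -/
theorem exists_properSpace_metric {X : Type*} {S : MobiusStructure X} (hcomp : MobiusCompact S)
    {d : ExtMetric X} (hdM : d ∈ S.M) {ω : X} (hd : d.rem = some ω) :
    ∃ _ : MetricSpace {x : X // x ≠ ω}, ProperSpace {x : X // x ≠ ω} ∧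
      ∀ x y : {x : X // x ≠ ω}, dist x y = d.fd x y := by
  let m : MetricSpace {x : X // x ≠ ω} :=
    { dist := fun x y => d.fd x y
      dist_self := fun x => d.fd_self x
      dist_comm := fun x y => d.fd_comm x y
      dist_triangle := fun x y z => ExtMetric.fd_triangle hd x.2 y.2 z.2
      eq_of_dist_eq_zero := fun {x y} h => by
        by_contra hne
        exact (ExtMetric.fd_pos (d := d) (fun h' => hne (Subtype.ext h'))).ne' h }
  refine ⟨m, ⟨fun p r => ?_⟩, fun _ _ => rfl⟩
  have hdist : ∀ x y : {x : X // x ≠ ω}, dist x y = d.fd x y := fun _ _ => rfl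
  have hremp : ∀ q : {x : X // x ≠ ω}, d.rem ≠ some q.1 := fun q h =>
    q.2 (Option.some.inj (h.symm.trans hd))
  refine IsCompact.of_isClosed_subset (s := Metric.closedBall p (max r 1)) ?_
    Metric.isClosed_closedBall (Metric.closedBall_subset_closedBall (le_max_left _ _))
  refine isCompact_iff_ultrafilter_le_nhds.2 fun F hF => ?_
  let t : TopologicalSpace X := mobiusTop S
  have hball : ∀ (q : {x : X // x ≠ ω}) (ε : ℝ), 0 < ε →
      IsOpen {y : X | d.d y q < ENNReal.ofReal ε} := fun q ε hε =>
    TopologicalSpace.isOpen_generateFrom_of_mem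
      ⟨d, hdM, q, hremp q, ENNReal.ofReal ε, ENNReal.ofReal_pos.2 hε, ENNReal.ofReal_ne_top,
        Or.inl rfl⟩
  have hr : 0 < max r 1 := lt_max_of_lt_right one_pos
  have hK : IsCompact {y : X | d.d y p ≤ ENNReal.ofReal (max r 1)} :=
    isCompact_mobiusTop_closedBall hcomp hdM (hremp p) (ENNReal.ofReal_pos.2 hr)
      ENNReal.ofReal_ne_top
  have hle : ∀ (q y : {x : X // x ≠ ω}) (ε : ℝ), 0 ≤ ε →
      (d.d y q ≤ ENNReal.ofReal ε ↔ dist y q ≤ ε) := fun q y ε hε => by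
    rw [ExtMetric.d_eq_ofReal hd y.2 q.2, ENNReal.ofReal_le_ofReal_iff hε, hdist]
  obtain ⟨x, hx, hFx⟩ := hK.ultrafilter_le_nhds (F.map Subtype.val) (by
    rw [Filter.le_principal_iff] at hF ⊢
    exact Filter.mem_of_superset (x := Metric.closedBall p (max r 1)) hF
      fun y hy => (hle p y _ hr.le).2 hy)
  have hxω : x ≠ ω := by
    rintro rfl
    refine absurd (show d.d _ _ ≤ _ from hx) (not_le.2 ?_)
    rw [(d.d_eq_top_iff _ _).2 ⟨p.2.symm, Or.inl hd⟩]
    exact ENNReal.ofReal_lt_top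
  refine ⟨⟨x, hxω⟩, (hle p ⟨x, hxω⟩ _ hr.le).1 hx, ?_⟩
  rw [Metric.nhds_basis_ball.ge_iff]
  intro ε hε
  have hmem := hFx ((hball ⟨x, hxω⟩ ε hε).mem_nhds
    (by simpa [d.d_self] using hε))
  refine Filter.mem_of_superset hmem fun y hy => ?_
  rw [Metric.mem_ball, hdist]
  have hy' : d.d y x < ENNReal.ofReal ε := hy
  rw [ExtMetric.d_eq_ofReal hd y.2 hxω] at hy'
  exact (ENNReal.ofReal_lt_ofReal_iff hε).1 hy'

/-- Every point of a Ptolemy space is infinitely remote for some metric of the structure. -/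
theorem exists_metric_rem_eq {X : Type*} {S : MobiusStructure X} (hpt : IsPtolemyStructure S)
    (ω : X) : ∃ d ∈ S.M, d.rem = some ω := by
  classical
  obtain ⟨d, hdM⟩ := S.nonempty
  let w : X → ℝ := fun x => if x = ω then 1 else (d.fd x ω)⁻¹
  have hw : ∀ x, 0 < w x := fun x => by
    by_cases h : x = ω
    · simp [w, h]
    · simpa [w, h] using ExtMetric.fd_pos (d := d) h
  have hwω : w ω = 1 := by simp [w]
  have hw' : ∀ x, x ≠ ω → w x * d.fd x ω = 1 := fun x h => by
    simp only [w, if_neg h]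
    exact inv_mul_cancel₀ (ExtMetric.fd_pos (d := d) h).ne'
  let D : X → X → ℝ≥0∞ := fun x y =>
    if x ≠ y ∧ (x = ω ∨ y = ω) then ⊤ else ENNReal.ofReal (w x * w y * d.fd x y)
  have hnn : ∀ x y, 0 ≤ w x * w y * d.fd x y := fun x y =>
    mul_nonneg (mul_pos (hw x) (hw y)).le (ExtMetric.fd_nonneg _ _)
  have hDtop : ∀ x y, D x y = ⊤ ↔ x ≠ y ∧ (x = ω ∨ y = ω) := fun x y => by
    simp only [D]
    split_ifs with h
    · simp [h]
    · simp [h, ENNReal.ofReal_ne_top]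
  have hDfin : ∀ x y, x ≠ ω → y ≠ ω → D x y = ENNReal.ofReal (w x * w y * d.fd x y) :=
    fun x y hx hy => by simp [D, hx, hy]
  have hself : ∀ x, D x x = 0 := fun x => by simp [D, d.fd_self]
  let d' : ExtMetric X :=
    { d := D
      rem := some ω
      symm := fun x y => by
        simp only [D, ne_comm (a := x), or_comm (a := x = ω), d.fd_comm x y, mul_comm (w x)]
      d_self := hself
      pos := fun x y h => by
        simp only [D]
        split_ifs
        · exact ENNReal.zero_lt_top
        · exact ENNReal.ofReal_pos.2 (mul_pos (mul_pos (hw x) (hw y)) (ExtMetric.fd_pos h))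
      triangle := fun x y z => by
        by_cases hxy : x = y
        · rw [hxy]; exact le_add_self
        by_cases hyz : y = z
        · rw [hyz]; exact le_self_add
        by_cases hx : x = ω
        · rw [(hDtop x y).2 ⟨hxy, Or.inl hx⟩, top_add]; exact le_top
        by_cases hz : z = ω
        · rw [(hDtop y z).2 ⟨hyz, Or.inr hz⟩, add_top]; exact le_top
        by_cases hy : y = ω
        · rw [(hDtop x y).2 ⟨hxy, Or.inr hy⟩, top_add]; exact le_top
        rw [hDfin x z hx hz, hDfin x y hx hy, hDfin y z hy hz,
          ← ENNReal.ofReal_add (hnn _ _) (hnn _ _)]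
        refine ENNReal.ofReal_le_ofReal ?_
        have hP := (hpt d hdM x y z ω
          ⟨fun h => hxy h.1, fun h => hxy h.1, fun h => hz h.2, fun h => hyz h.1⟩).2.1
        simp only [crtVec] at hP
        have h2 := mul_le_mul_of_nonneg_left hP
          (mul_pos (mul_pos (hw x) (hw y)) (hw z)).le
        linear_combination h2 - w x * w z * d.fd x z * hw' y hy
          + w x * w y * d.fd x y * hw' z hz + w y * w z * d.fd y z * hw' x hx
      d_eq_top_iff := fun x y => by
        rw [hDtop]
        simp only [Option.some.injEq, eq_comm (a := ω)] }
  have hfd : ∀ x y, d'.fd x y = w x * w y * d.fd x y := fun x y => by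
    change (if D x y = ⊤ then 1 else (D x y).toReal) = _
    simp only [hDtop]
    split_ifs with h
    · obtain ⟨hne, rfl | rfl⟩ := h
      · rw [hwω, one_mul, d.fd_comm, hw' y hne.symm]
      · rw [hwω, mul_one, hw' x hne]
    · simp only [D, if_neg h, ENNReal.toReal_ofReal (hnn x y)]
  refine ⟨d', S.maximal d' fun d₁ hd₁ x y z u hadm => ?_, rfl⟩
  refine (S.compat d hdM d₁ hd₁ x y z u hadm).trans'
    ⟨w x * w y * w z * w u, mul_pos (mul_pos (mul_pos (hw x) (hw y)) (hw z)) (hw u), ?_⟩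
  simp only [crtVec, hfd, Prod.smul_mk, smul_eq_mul, Prod.mk.injEq]
  refine ⟨?_, ?_, ?_⟩ <;> ring

section Automorphisms

variable {X : Type*} {S : MobiusStructure X}

theorem Admissible.map {f : X → X} (hf : Function.Injective f) {x y z u : X}
    (h : Admissible x y z u) : Admissible (f x) (f y) (f z) (f u) := by
  simpa only [Admissible, hf.eq_iff] using h

theorem IsMobiusAuto.comp {f g : X → X} (hf : IsMobiusAuto S f) (hg : IsMobiusAuto S g) :
    IsMobiusAuto S (f ∘ g) :=
  ⟨hf.1.comp hg.1, fun d hd x y z u h =>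
    (hg.2 d hd x y z u h).symm.trans' (hf.2 d hd _ _ _ _ (h.map hg.1.1))⟩

theorem IsMobiusAuto.id : IsMobiusAuto S (id : X → X) :=
  ⟨Function.bijective_id, fun _ _ _ _ _ _ _ => ProjEq.refl _⟩

variable {d : ExtMetric X} (hdM : d ∈ S.M) {ω : X} (hd : d.rem = some ω)
include hdM hd

/-- A bijection fixing the remote point and scaling the metric is a Möbius automorphism. -/
theorem IsMobiusAuto.of_scaling {f : X → X} (hf : Function.Bijective f) (hω : f ω = ω)
    {c : ℝ} (hc : 0 < c) (hfc : ∀ x y, x ≠ ω → y ≠ ω → d.fd (f x) (f y) = c * d.fd x y) :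
    IsMobiusAuto S f := by
  classical
  have hne : ∀ x, x ≠ ω → f x ≠ ω := fun x hx h => hx (hf.1 (h.trans hω.symm))
  let t : X → ℝ := fun x => if x = ω then (Real.sqrt c)⁻¹ else Real.sqrt c
  have hsq : 0 < Real.sqrt c := Real.sqrt_pos.2 hc
  have ht : ∀ x, 0 < t x := fun x => by
    simp only [t]
    split_ifs
    · exact inv_pos.2 hsq
    · exact hsq
  have hft : ∀ x y, d.fd (f x) (f y) = t x * t y * d.fd x y := fun x y => by
    by_cases hx : x = ω <;> by_cases hy : y = ω
    · rw [hx, hy, d.fd_self, d.fd_self, mul_zero]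
    · rw [hx, hω, d.fd_comm, d.fd_comm ω y, ExtMetric.fd_rem hd hy,
        ExtMetric.fd_rem hd (hne y hy)]
      simp [t, hy, hsq.ne']
    · rw [hy, hω, ExtMetric.fd_rem hd hx, ExtMetric.fd_rem hd (hne x hx)]
      simp [t, hx, hsq.ne']
    · rw [hfc x y hx hy]
      simp only [t, if_neg hx, if_neg hy, Real.mul_self_sqrt hc.le]
  refine ⟨hf, fun d₁ hd₁ x y z u hadm => ?_⟩
  have h : ProjEq (crtVec d x y z u) (crtVec d (f x) (f y) (f z) (f u)) := by
    refine ⟨t x * t y * t z * t u,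
      mul_pos (mul_pos (mul_pos (ht x) (ht y)) (ht z)) (ht u), ?_⟩
    simp only [crtVec, hft, Prod.smul_mk, smul_eq_mul, Prod.mk.injEq]
    refine ⟨?_, ?_, ?_⟩ <;> ring
  exact ((S.compat d hdM d₁ hd₁ x y z u hadm).trans' h).symm.trans'
    (S.compat d hdM d₁ hd₁ _ _ _ _ (hadm.map hf.1))

/-- A Möbius automorphism fixing the remote point scales the metric. -/
theorem IsMobiusAuto.exists_scaling {f : X → X} (hf : IsMobiusAuto S f) (hω : f ω = ω) :
    ∃ c : ℝ, 0 < c ∧ ∀ x y, x ≠ ω → y ≠ ω → d.fd (f x) (f y) = c * d.fd x y := by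
  have hne : ∀ x, x ≠ ω → f x ≠ ω := fun x hx h => hx (hf.1.1 (h.trans hω.symm))
  have htri : ∀ x y z, x ≠ ω → y ≠ ω → z ≠ ω → x ≠ y → ∃ l : ℝ, 0 < l ∧
      d.fd (f x) (f y) = l * d.fd x y ∧ d.fd (f x) (f z) = l * d.fd x z ∧
      d.fd (f y) (f z) = l * d.fd y z := fun x y z hx hy hz hxy => by
    obtain ⟨l, hl, h⟩ := hf.2 d hdM x y z ω
      ⟨fun h => hxy h.1, fun h => hxy h.1, fun h => hz h.2, fun h => hz h.2⟩
    refine ⟨l, hl, ?_⟩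
    simpa [crtVec, hω, ExtMetric.fd_rem hd, hx, hy, hz, hne] using h
  by_cases hY : ∃ p q, p ≠ ω ∧ q ≠ ω ∧ p ≠ q
  · obtain ⟨p, q, hp, hq, hpq⟩ := hY
    obtain ⟨c, hc, hpqc, -⟩ := htri p q q hp hq hq hpq
    have hpx : ∀ x, x ≠ ω → d.fd (f p) (f x) = c * d.fd p x := fun x hx => by
      obtain ⟨l, -, h1, h2, -⟩ := htri p q x hp hq hx hpq
      rwa [mul_right_cancel₀ (ExtMetric.fd_pos hpq).ne' (h1.symm.trans hpqc)] at h2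
    refine ⟨c, hc, fun x y hx hy => ?_⟩
    by_cases hxp : p = x
    · rw [← hxp]; exact hpx y hy
    · obtain ⟨l, -, h1, -, h3⟩ := htri p x y hp hx hy hxp
      rwa [mul_right_cancel₀ (ExtMetric.fd_pos hxp).ne' (h1.symm.trans (hpx x hx))] at h3
  · push Not at hY
    refine ⟨1, one_pos, fun x y hx hy => ?_⟩
    rw [hY x y hx hy, d.fd_self, d.fd_self, mul_zero]

/-- A space inversion exchanging the centre `z` and the remote point of `d` and preserving a
nonempty sphere of radius `r` inverts the distances to `z`. -/
theorem IsSpaceInversion.fd_mul_fd {φ : X → X} {z : X} (hz : z ≠ ω) {Sp : Set X}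
    (hφ : IsSpaceInversion S z ω Sp φ) {r : ℝ≥0∞} (hSp : Sp = {x | d.d x z = r})
    {y : X} (hyω : y ≠ ω) (hyz : y ≠ z) (hy : d.d y z = r) {x : X} (hxω : x ≠ ω)
    (hxz : x ≠ z) : d.fd (φ x) z * d.fd x z = d.fd y z ^ 2 := by
  obtain ⟨hauto, hinv, -, hzω, himg, -⟩ := hφ
  have hωz : φ ω = z := by rw [← hzω, hinv]
  have hneω : ∀ x, x ≠ z → φ x ≠ ω := fun x hx h => hx (hauto.1.1 (h.trans hzω.symm))
  have hφy : d.fd (φ y) z = d.fd y z := by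
    have h1 : φ y ∈ Sp := by
      rw [← himg]
      exact ⟨y, by rw [hSp]; exact hy, rfl⟩
    rw [hSp] at h1
    have h2 : d.d (φ y) z = d.d y z := h1.trans hy.symm
    simp only [ExtMetric.fd, h2]
  by_cases hxy : x = y
  · rw [hxy, hφy, sq]
  obtain ⟨l, hl, h⟩ := hauto.2 d hdM x y z ω
    ⟨fun h => hxy h.1, fun h => hxy h.1, fun h => hz h.2, fun h => hz h.2⟩
  have hcross : d.fd (φ y) z = l * d.fd x z ∧ d.fd (φ x) z = l * d.fd y z := by
    have h' := h
    simp only [crtVec, hzω, hωz, ExtMetric.fd_rem hd hxω, ExtMetric.fd_rem hd hyω,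
      ExtMetric.fd_rem hd (hneω x hxz), ExtMetric.fd_rem hd (hneω y hyz),
      Prod.smul_mk, smul_eq_mul, Prod.mk.injEq, mul_one, one_mul] at h'
    exact h'.2
  rw [hcross.2, sq]
  linear_combination d.fd y z * (hφy - hcross.1)

/-- If the distances to `z` are not constant, some Möbius automorphism fixing `z` and the
remote point is not an isometry. -/
theorem exists_mobiusAuto_fd_ne (hI : PropertyI S) {z x y : X} (hz : z ≠ ω) (hx : x ≠ ω)
    (hy : y ≠ ω) (hxz : x ≠ z) (hyz : y ≠ z) (hne : d.fd x z ≠ d.fd y z) :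
    ∃ f, IsMobiusAuto S f ∧ f ω = ω ∧ f z = z ∧ d.fd (f x) z ≠ d.fd x z := by
  have hex : ∀ w, w ≠ ω → w ≠ z → ∃ φ, IsSpaceInversion S z ω {u | d.d u z = d.d w z} φ :=
    fun w hw hwz => (hI z ω hz _
      ⟨d, hdM, hd, d.d w z, d.pos w z hwz, ExtMetric.d_ne_top hd hw hz, rfl⟩).exists
  obtain ⟨φ, hφ⟩ := hex x hx hxz
  obtain ⟨ψ, hψ⟩ := hex y hy hyz
  have hωφ : φ ω = z := by rw [← hφ.2.2.2.1, hφ.2.1]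
  have hωψ : ψ ω = z := by rw [← hψ.2.2.2.1, hψ.2.1]
  refine ⟨ψ ∘ φ, hψ.1.comp hφ.1, ?_, ?_, fun heq => hne ?_⟩
  · rw [Function.comp_apply, hωφ, hψ.2.2.2.1]
  · rw [Function.comp_apply, hφ.2.2.2.1, hωψ]
  have hφω : φ x ≠ ω := fun h => hxz (hφ.1.1.1 (h.trans hφ.2.2.2.1.symm))
  have hφz : φ x ≠ z := fun h => hx (hφ.1.1.1 (h.trans hωφ.symm))
  have h1 := hφ.fd_mul_fd hdM hd hz rfl hx hxz rfl hx hxz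
  have h2 := hψ.fd_mul_fd hdM hd hz rfl hy hyz rfl hφω hφz
  have hpos := ExtMetric.fd_pos (d := d) hxz
  rw [sq] at h1
  rw [mul_right_cancel₀ hpos.ne' h1] at h2
  rw [Function.comp_apply] at heq
  rw [heq, ← sq] at h2
  exact (pow_left_inj₀ (ExtMetric.fd_nonneg _ _) (ExtMetric.fd_nonneg _ _) two_ne_zero).1 h2

end Automorphisms

/-- The stabilizer of a point acts transitively on its complement. -/
theorem exists_mobiusAuto_fixing {X : Type*} {S : MobiusStructure X}
    (hpt : IsPtolemyStructure S) (hcomp : MobiusCompact S) (hI : PropertyI S)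
    {ω x z : X} (hx : x ≠ ω) (hz : z ≠ ω) :
    ∃ f : X → X, IsMobiusAuto S f ∧ f ω = ω ∧ f x = z := by
  classical
  obtain ⟨d, hdM, hd⟩ := exists_metric_rem_eq hpt ω
  obtain ⟨_, _, hdist⟩ := exists_properSpace_metric hcomp hdM hd
  obtain ⟨g, c, hc, hg, hgx⟩ :=
    exists_scaling_map_eq (Y := {x : X // x ≠ ω}) (fun z x y hxz hyz hne => by
      rw [hdist, hdist] at hne
      obtain ⟨f, hf, hfω, hfz, hfx⟩ := exists_mobiusAuto_fd_ne hdM hd hI z.2 x.2 y.2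
        (fun h => hxz (Subtype.ext h)) (fun h => hyz (Subtype.ext h)) hne
      obtain ⟨c, hc, hfc⟩ := hf.exists_scaling hdM hd hfω
      let e : Equiv.Perm X := Equiv.ofBijective f hf.1
      refine ⟨e.subtypePerm fun p => ?_, c, hc, ?_, fun p q => ?_, Subtype.ext hfz⟩
      · exact not_congr ⟨fun h => e.injective (h.trans hfω.symm), fun h => by rw [h]; exact hfω⟩
      · rintro rfl
        apply hfx
        rw [← one_mul (d.fd x z), ← hfc x z x.2 z.2, hfz]
      · rw [hdist, hdist]
        exact hfc p q p.2 q.2) ⟨x, hx⟩ ⟨z, hz⟩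
  have hval : ∀ (p : X) (hp : p ≠ ω), Equiv.Perm.ofSubtype g p = (g ⟨p, hp⟩ : X) :=
    fun p hp => Equiv.Perm.ofSubtype_apply_of_mem g hp
  have hω : Equiv.Perm.ofSubtype g ω = ω :=
    Equiv.Perm.ofSubtype_apply_of_not_mem g (not_not.2 rfl)
  refine ⟨Equiv.Perm.ofSubtype g, IsMobiusAuto.of_scaling hdM hd (Equiv.bijective _) hω hc
    (fun p q hp hq => ?_), hω, ?_⟩
  · have h := hg ⟨p, hp⟩ ⟨q, hq⟩
    rw [hdist, hdist] at h
    rwa [hval p hp, hval q hq]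
  · rw [hval x hx, hgx]

/-- Proposition 5.1 of the paper.  Every compact Ptolemy space with
the inversion property (I) is two-point homogeneous: for any ordered pairs `(x,y)` and
`(x',y')` of distinct points there is a Möbius automorphism `f` with `f x = x'` and
`f y = y'`. -/
theorem stmt_8 {X : Type*} (S : MobiusStructure X)
    (hpt : IsPtolemyStructure S) (hcomp : MobiusCompact S) (hI : PropertyI S)
    (x y x' y' : X) (hxy : x ≠ y) (hxy' : x' ≠ y') :
    ∃ f : X → X, IsMobiusAuto S f ∧ f x = x' ∧ f y = y' := by
  obtain ⟨g, hg, hgx⟩ : ∃ g : X → X, IsMobiusAuto S g ∧ g x = x' := by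
    by_cases h : x = x'
    · exact ⟨id, IsMobiusAuto.id, h⟩
    · obtain ⟨d, hdM, hd⟩ := exists_metric_rem_eq hpt x'
      obtain ⟨φ, hφ⟩ := (hI x x' h _
        ⟨d, hdM, hd, 1, one_pos, ENNReal.one_ne_top, rfl⟩).exists
      exact ⟨φ, hφ.1, hφ.2.2.2.1⟩
  have hgy : g y ≠ x' := fun h => hxy (hg.1.1 (hgx.trans h.symm))
  obtain ⟨f, hf, hfx, hfy⟩ := exists_mobiusAuto_fixing hpt hcomp hI hgy hxy'.symm
  exact ⟨f ∘ g, hf.comp hg, by rw [Function.comp_apply, hgx, hfx], hfy⟩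

end Mobius
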